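/- Let (A, L) be a random financial network and b > 0. The set of optimal allocations { Y ∈ 𝒞 : Σ_{i=1}^N Y_i = ρ_b(A, L) ℙ-a.s. and η(Λ(A+Y, L)) ≤ b } is convex: if Y⁽¹⁾ and Y⁽²⁾ are optimal and λ ∈ [0,1], then λY⁽¹⁾ + (1−λ)Y⁽²⁾ is optimal. -/

import Mathlib

open MeasureTheory

/-- Total liability vector: `ℓ̄_i = ∑_j ℓ_{ij}`. -/
noncomputable def lbar {N : ℕ} (ℓ : Fin N → Fin N → ℝ) : Fin N → ℝ := fun i => ∑ j, ℓ i j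

/-- Relative liability matrix: `π_{ij} = ℓ_{ij}/ℓ̄_i` if `ℓ̄_i > 0`, else `0`. -/
noncomputable def relPi {N : ℕ} (ℓ : Fin N → Fin N → ℝ) : Fin N → Fin N → ℝ :=
  fun i j => if 0 < lbar ℓ i then ℓ i j / lbar ℓ i else 0

/-- The Eisenberg–Noe clearing map `Φ(p, a, π, ℓ̄) = (πᵀp + a) ∧ ℓ̄`. -/
noncomputable def Phi {N : ℕ} (π : Fin N → Fin N → ℝ) (a lb p : Fin N → ℝ) : Fin N → ℝ :=
  fun i => min ((∑ j, π j i * p j) + a i) (lb i)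

/-- The clearing vector `CV(a, ℓ)`: the (for `a ∈ ℝ^N_{++}` unique) nonnegative fixed
point of the clearing map associated with the liability matrix `ℓ`. -/
noncomputable def clearingVec {N : ℕ} (a : Fin N → ℝ) (ℓ : Fin N → Fin N → ℝ) : Fin N → ℝ :=
  Classical.epsilon fun p => (∀ i, 0 ≤ p i) ∧ Phi (relPi ℓ) a (lbar ℓ) p = p

/-- The Eisenberg–Noe aggregation function `Λ(a, ℓ) = ∑_i (ℓ̄_i − CV_i(a, ℓ))`. -/
noncomputable def aggLoss {N : ℕ} (a : Fin N → ℝ) (ℓ : Fin N → Fin N → ℝ) : ℝ :=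
  ∑ i, (lbar ℓ i - clearingVec a ℓ i)

/-- The feasible total bailout-capital levels: constants `c` such that some admissible
random allocation `Y ∈ 𝒞` with `∑ᵢ Yᵢ = c` a.s. makes the system acceptable. -/
noncomputable def feas {Ω : Type*} [MeasurableSpace Ω] (P : Measure Ω) {N : ℕ}
    (η : (Ω → ℝ) → ℝ) (A : Ω → Fin N → ℝ) (L : Ω → Fin N → Fin N → ℝ) (b : ℝ) : Set ℝ :=
  {c : ℝ | ∃ Y : Ω → Fin N → ℝ, Measurable Y ∧ (∀ ω i, 0 ≤ Y ω i) ∧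
    (∀ᵐ ω ∂P, ∑ i, Y ω i = c) ∧
    η (fun ω => aggLoss (fun i => A ω i + Y ω i) (L ω)) ≤ b}

/-- The systemic risk measure `ρ_b(A, L)`. -/
noncomputable def sysRisk {Ω : Type*} [MeasurableSpace Ω] (P : Measure Ω) {N : ℕ}
    (η : (Ω → ℝ) → ℝ) (A : Ω → Fin N → ℝ) (L : Ω → Fin N → Fin N → ℝ) (b : ℝ) : ℝ :=
  sInf (feas P η A L b)

lemma lbar_nonneg {N : ℕ} {ℓ : Fin N → Fin N → ℝ} (hℓ : ∀ i j, 0 ≤ ℓ i j) (i : Fin N) :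
    0 ≤ lbar ℓ i :=
  Finset.sum_nonneg fun j _ => hℓ i j

lemma relPi_nonneg {N : ℕ} {ℓ : Fin N → Fin N → ℝ} (hℓ : ∀ i j, 0 ≤ ℓ i j) (i j : Fin N) :
    0 ≤ relPi ℓ i j := by
  unfold relPi
  split_ifs with h
  · exact div_nonneg (hℓ i j) h.le
  · exact le_rfl

lemma Phi_mono {N : ℕ} {π : Fin N → Fin N → ℝ} (hπ : ∀ i j, 0 ≤ π i j) (a lb : Fin N → ℝ) :
    Monotone (Phi π a lb) := by
  intro p q hpq i
  exact min_le_min_right _ (add_le_add_left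
    (Finset.sum_le_sum fun j _ => mul_le_mul_of_nonneg_left (hpq j) (hπ j i)) _)

lemma Phi_nonneg {N : ℕ} {π : Fin N → Fin N → ℝ} (hπ : ∀ i j, 0 ≤ π i j) {a lb p : Fin N → ℝ}
    (ha : ∀ i, 0 ≤ a i) (hlb : ∀ i, 0 ≤ lb i) (hp : 0 ≤ p) : 0 ≤ Phi π a lb p := fun i =>
  le_min (add_nonneg (Finset.sum_nonneg fun j _ => mul_nonneg (hπ j i) (hp j)) (ha i)) (hlb i)

lemma continuous_Phi {N : ℕ} (π : Fin N → Fin N → ℝ) (a lb : Fin N → ℝ) :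
    Continuous (Phi π a lb) := by
  unfold Phi
  fun_prop

/-- Comparison principle: for positive endowments, every sub-fixed point of the clearing map lies
below every nonnegative fixed point. -/
lemma le_of_le_Phi {N : ℕ} {π : Fin N → Fin N → ℝ} (hπ : ∀ i j, 0 ≤ π i j)
    {a lb r p : Fin N → ℝ} (ha : ∀ i, 0 < a i) (hr : r ≤ Phi π a lb r)
    (hp : 0 ≤ p) (hfix : Phi π a lb p = p) : r ≤ p := by
  by_contra hle
  obtain ⟨k, hk⟩ : ∃ k, p k < r k := by
    simpa [Pi.le_def] using hle
  have hpay : ∀ i, p i < r i → p i = (∑ j, π j i * p j) + a i := by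
    intro i hi
    have h1 : min ((∑ j, π j i * p j) + a i) (lb i) = p i := congrFun hfix i
    have h2 : r i ≤ lb i := (hr i).trans (min_le_right _ _)
    rcases min_choice ((∑ j, π j i * p j) + a i) (lb i) with h | h <;> linarith
  have hpos : ∀ i, p i < r i → 0 < p i := by
    intro i hi
    rw [hpay i hi]
    exact add_pos_of_nonneg_of_pos
      (Finset.sum_nonneg fun j _ => mul_nonneg (hπ j i) (hp j)) (ha i)
  obtain ⟨i, hi, hmax⟩ := Finset.exists_max_image
    (Finset.univ.filter fun i => p i < r i) (fun i => r i / p i) ⟨k, by simpa using hk⟩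
  have hi : p i < r i := by simpa using hi
  have hpi := hpos i hi
  set c := r i / p i with hc
  have hc1 : 1 < c := (one_lt_div hpi).2 hi
  have hrc : ∀ j, r j ≤ c * p j := by
    intro j
    by_cases hj : p j < r j
    · exact (div_le_iff₀ (hpos j hj)).1 (hmax j (by simpa using hj))
    · nlinarith [hp j, not_lt.1 hj, show (0 : ℝ) ≤ p j from hp j]
  have hri : r i = c * p i := by
    rw [hc, div_mul_cancel₀ _ hpi.ne']
  have h1 : r i ≤ (∑ j, π j i * r j) + a i := (hr i).trans (min_le_left _ _)
  have h2 : ∑ j, π j i * r j ≤ c * ∑ j, π j i * p j := by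
    rw [Finset.mul_sum]
    refine Finset.sum_le_sum fun j _ => ?_
    calc π j i * r j ≤ π j i * (c * p j) := mul_le_mul_of_nonneg_left (hrc j) (hπ j i)
      _ = c * (π j i * p j) := by ring
  nlinarith [hpay i hi, ha i]

/-- The iterates of the clearing map started at zero. -/
noncomputable def clearingIter {N : ℕ} (a : Fin N → ℝ) (ℓ : Fin N → Fin N → ℝ) (n : ℕ) :
    Fin N → ℝ :=
  (Phi (relPi ℓ) a (lbar ℓ))^[n] 0

lemma clearingIter_succ {N : ℕ} (a : Fin N → ℝ) (ℓ : Fin N → Fin N → ℝ) (n : ℕ) :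
    clearingIter a ℓ (n + 1) = Phi (relPi ℓ) a (lbar ℓ) (clearingIter a ℓ n) :=
  Function.iterate_succ_apply' _ _ _

section Clearing

variable {N : ℕ} {a : Fin N → ℝ} {ℓ : Fin N → Fin N → ℝ}

lemma monotone_clearingIter (ha : ∀ i, 0 ≤ a i) (hℓ : ∀ i j, 0 ≤ ℓ i j) :
    Monotone (clearingIter a ℓ) :=
  (Phi_mono (relPi_nonneg hℓ) _ _).monotone_iterate_of_le_map
    (Phi_nonneg (relPi_nonneg hℓ) ha (lbar_nonneg hℓ) le_rfl)

lemma clearingIter_le_lbar (hℓ : ∀ i j, 0 ≤ ℓ i j) (n : ℕ) : clearingIter a ℓ n ≤ lbar ℓ := by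
  cases n with
  | zero => exact lbar_nonneg hℓ
  | succ n =>
    rw [clearingIter_succ]
    exact fun i => min_le_right _ _

lemma exists_tendsto_clearingIter (ha : ∀ i, 0 ≤ a i) (hℓ : ∀ i j, 0 ≤ ℓ i j) :
    ∃ p : Fin N → ℝ, Filter.Tendsto (clearingIter a ℓ) Filter.atTop (nhds p) ∧
      (∀ i, 0 ≤ p i) ∧ Phi (relPi ℓ) a (lbar ℓ) p = p := by
  have hmono := monotone_clearingIter ha hℓ
  have hlim : Filter.Tendsto (clearingIter a ℓ) Filter.atTop (nhds (⨆ n, clearingIter a ℓ n)) :=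
    tendsto_atTop_ciSup hmono
      ⟨lbar ℓ, Set.forall_mem_range.2 (clearingIter_le_lbar hℓ)⟩
  refine ⟨_, hlim, hmono.ge_of_tendsto hlim 0, ?_⟩
  refine tendsto_nhds_unique ?_ ((Filter.tendsto_add_atTop_iff_nat 1).2 hlim)
  simp only [clearingIter_succ]
  exact ((continuous_Phi _ _ _).tendsto _).comp hlim

lemma clearingVec_spec (ha : ∀ i, 0 ≤ a i) (hℓ : ∀ i j, 0 ≤ ℓ i j) :
    (∀ i, 0 ≤ clearingVec a ℓ i) ∧
      Phi (relPi ℓ) a (lbar ℓ) (clearingVec a ℓ) = clearingVec a ℓ :=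
  Classical.epsilon_spec (p := fun p : Fin N → ℝ =>
      (∀ i, 0 ≤ p i) ∧ Phi (relPi ℓ) a (lbar ℓ) p = p)
    ((exists_tendsto_clearingIter ha hℓ).imp fun _ h => h.2)

lemma clearingVec_le_lbar (ha : ∀ i, 0 ≤ a i) (hℓ : ∀ i j, 0 ≤ ℓ i j) (i : Fin N) :
    clearingVec a ℓ i ≤ lbar ℓ i := by
  rw [← (clearingVec_spec ha hℓ).2]
  exact min_le_right _ _

lemma tendsto_clearingIter (ha : ∀ i, 0 < a i) (hℓ : ∀ i j, 0 ≤ ℓ i j) :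
    Filter.Tendsto (clearingIter a ℓ) Filter.atTop (nhds (clearingVec a ℓ)) := by
  obtain ⟨p, hlim, hp0, hp⟩ := exists_tendsto_clearingIter (fun i => (ha i).le) hℓ
  obtain ⟨hq0, hq⟩ := clearingVec_spec (fun i => (ha i).le) hℓ
  rwa [le_antisymm (le_of_le_Phi (relPi_nonneg hℓ) ha hq.ge hp0 hp)
    (le_of_le_Phi (relPi_nonneg hℓ) ha hp.ge hq0 hq)]

/-- The clearing vector is concave in the endowments. -/
lemma clearingVec_concave {a₁ a₂ : Fin N → ℝ} (ha₁ : ∀ i, 0 < a₁ i) (ha₂ : ∀ i, 0 < a₂ i)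
    (hℓ : ∀ i j, 0 ≤ ℓ i j) {t : ℝ} (ht0 : 0 ≤ t) (ht1 : t ≤ 1) (i : Fin N) :
    t * clearingVec a₁ ℓ i + (1 - t) * clearingVec a₂ ℓ i ≤
      clearingVec (fun i => t * a₁ i + (1 - t) * a₂ i) ℓ i := by
  have hs : 0 ≤ 1 - t := sub_nonneg.2 ht1
  have ha : ∀ i, 0 < t * a₁ i + (1 - t) * a₂ i := fun i =>
    convex_Ioi (0 : ℝ) (ha₁ i) (ha₂ i) ht0 hs (by ring)
  obtain ⟨-, hp⟩ := clearingVec_spec (fun i => (ha₁ i).le) hℓ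
  obtain ⟨-, hq⟩ := clearingVec_spec (fun i => (ha₂ i).le) hℓ
  obtain ⟨hr0, hr⟩ := clearingVec_spec (fun i => (ha i).le) hℓ
  set p := clearingVec a₁ ℓ
  set q := clearingVec a₂ ℓ
  refine le_of_le_Phi (r := fun i => t * p i + (1 - t) * q i)
    (relPi_nonneg hℓ) ha (fun i => ?_) hr0 hr i
  have hpi : p i = min ((∑ j, relPi ℓ j i * p j) + a₁ i) (lbar ℓ i) := (congrFun hp i).symm
  have hqi : q i = min ((∑ j, relPi ℓ j i * q j) + a₂ i) (lbar ℓ i) := (congrFun hq i).symm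
  have hsum : ∑ j, relPi ℓ j i * (t * p j + (1 - t) * q j) =
      t * (∑ j, relPi ℓ j i * p j) + (1 - t) * ∑ j, relPi ℓ j i * q j := by
    rw [Finset.mul_sum, Finset.mul_sum, ← Finset.sum_add_distrib]
    exact Finset.sum_congr rfl fun j _ => by ring
  refine le_min ?_ ?_
  · rw [hsum]
    have h1 := mul_le_mul_of_nonneg_left (hpi.le.trans (min_le_left _ _)) ht0
    have h2 := mul_le_mul_of_nonneg_left (hqi.le.trans (min_le_left _ _)) hs
    linarith
  · have h1 := mul_le_mul_of_nonneg_left (hpi.le.trans (min_le_right _ _)) ht0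
    have h2 := mul_le_mul_of_nonneg_left (hqi.le.trans (min_le_right _ _)) hs
    linarith

lemma aggLoss_convex {a₁ a₂ : Fin N → ℝ} (ha₁ : ∀ i, 0 < a₁ i) (ha₂ : ∀ i, 0 < a₂ i)
    (hℓ : ∀ i j, 0 ≤ ℓ i j) {t : ℝ} (ht0 : 0 ≤ t) (ht1 : t ≤ 1) :
    aggLoss (fun i => t * a₁ i + (1 - t) * a₂ i) ℓ ≤
      t * aggLoss a₁ ℓ + (1 - t) * aggLoss a₂ ℓ := by
  unfold aggLoss
  rw [Finset.mul_sum, Finset.mul_sum, ← Finset.sum_add_distrib]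
  refine Finset.sum_le_sum fun i _ => ?_
  linarith [clearingVec_concave ha₁ ha₂ hℓ ht0 ht1 i]

lemma aggLoss_nonneg (ha : ∀ i, 0 ≤ a i) (hℓ : ∀ i j, 0 ≤ ℓ i j) : 0 ≤ aggLoss a ℓ :=
  Finset.sum_nonneg fun i _ => sub_nonneg.2 (clearingVec_le_lbar ha hℓ i)

lemma aggLoss_le (ha : ∀ i, 0 ≤ a i) (hℓ : ∀ i j, 0 ≤ ℓ i j) :
    aggLoss a ℓ ≤ ∑ i, ∑ j, ℓ i j :=
  Finset.sum_le_sum fun i _ => sub_le_self _ ((clearingVec_spec ha hℓ).1 i)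

end Clearing

section Measurability

variable {Ω : Type*} [MeasurableSpace Ω] {N : ℕ} {A : Ω → Fin N → ℝ} {L : Ω → Fin N → Fin N → ℝ}

lemma measurable_lbar (hL : Measurable L) (i : Fin N) : Measurable fun ω => lbar (L ω) i := by
  unfold lbar
  fun_prop

lemma measurable_relPi (hL : Measurable L) (i j : Fin N) :
    Measurable fun ω => relPi (L ω) i j := by
  have hb := measurable_lbar hL i
  unfold relPi
  exact Measurable.ite (measurableSet_lt measurable_const hb)
    (Measurable.div (by fun_prop) hb) measurable_const

lemma measurable_clearingIter (hA : Measurable A) (hL : Measurable L) (n : ℕ) :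
    Measurable fun ω => clearingIter (A ω) (L ω) n := by
  induction n with
  | zero => exact measurable_const
  | succ n ih =>
    simp only [clearingIter_succ]
    refine measurable_pi_lambda _ fun i => ?_
    refine Measurable.min (Measurable.add ?_ (by fun_prop)) (measurable_lbar hL i)
    exact Finset.measurable_sum _ fun j _ => (measurable_relPi hL j i).mul (by fun_prop)

lemma measurable_aggLoss (hA : Measurable A) (hApos : ∀ ω i, 0 < A ω i) (hL : Measurable L)
    (hLnn : ∀ ω i j, 0 ≤ L ω i j) : Measurable fun ω => aggLoss (A ω) (L ω) := by
  have hcv : Measurable fun ω => clearingVec (A ω) (L ω) :=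
    measurable_of_tendsto_metrizable (measurable_clearingIter hA hL)
      (tendsto_pi_nhds.2 fun ω => tendsto_clearingIter (hApos ω) (hLnn ω))
  exact Finset.measurable_sum _ fun i _ => (measurable_lbar hL i).sub (by fun_prop)

lemma integrable_aggLoss {P : Measure Ω} (hA : Measurable A) (hApos : ∀ ω i, 0 < A ω i)
    (hL : Measurable L) (hLnn : ∀ ω i j, 0 ≤ L ω i j)
    (hLint : Integrable (fun ω => ∑ i, ∑ j, L ω i j) P) :
    Integrable (fun ω => aggLoss (A ω) (L ω)) P := by
  refine hLint.mono' (measurable_aggLoss hA hApos hL hLnn).aestronglyMeasurable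
    (Filter.Eventually.of_forall fun ω => ?_)
  rw [Real.norm_of_nonneg (aggLoss_nonneg (fun i => (hApos ω i).le) (hLnn ω))]
  exact aggLoss_le (fun i => (hApos ω i).le) (hLnn ω)

end Measurability

/-- The set of optimal allocations is convex: any convex combination of two
optimal allocations is again an optimal allocation. -/
theorem optimal_allocations_convex
    {Ω : Type*} [MeasurableSpace Ω] (P : Measure Ω) [IsProbabilityMeasure P]
    (N : ℕ) (hN : 1 ≤ N)
    (η : (Ω → ℝ) → ℝ)
    (hη_mono : ∀ X Y : Ω → ℝ, Integrable X P → Integrable Y P →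
      (∀ᵐ ω ∂P, X ω ≤ Y ω) → η X ≤ η Y)
    (hη_conv : ∀ X Y : Ω → ℝ, Integrable X P → Integrable Y P → ∀ t : ℝ, 0 ≤ t → t ≤ 1 →
      η (fun ω => t * X ω + (1 - t) * Y ω) ≤ t * η X + (1 - t) * η Y)
    (hη_norm : η (fun _ => 0) = 0)
    (hη_cont : ∀ ε : ℝ, 0 < ε → ∃ δ : ℝ, 0 < δ ∧ ∀ X Y : Ω → ℝ,
      Integrable X P → Integrable Y P → (∫ ω, |X ω - Y ω| ∂P) < δ → |η X - η Y| < ε)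
    (A : Ω → Fin N → ℝ) (hA : Measurable A) (hApos : ∀ ω i, 0 < A ω i)
    (L : Ω → Fin N → Fin N → ℝ) (hL : Measurable L)
    (hLnn : ∀ ω i j, 0 ≤ L ω i j) (hLdiag : ∀ ω i, L ω i i = 0)
    (hLint : Integrable (fun ω => ∑ i, ∑ j, L ω i j) P)
    (b : ℝ) (hb : 0 < b)
    :
    ∀ Y₁ Y₂ : Ω → Fin N → ℝ,
      Measurable Y₁ → (∀ ω i, 0 ≤ Y₁ ω i) →
      (∀ᵐ ω ∂P, ∑ i, Y₁ ω i = sysRisk P η A L b) →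
      η (fun ω => aggLoss (fun i => A ω i + Y₁ ω i) (L ω)) ≤ b →
      Measurable Y₂ → (∀ ω i, 0 ≤ Y₂ ω i) →
      (∀ᵐ ω ∂P, ∑ i, Y₂ ω i = sysRisk P η A L b) →
      η (fun ω => aggLoss (fun i => A ω i + Y₂ ω i) (L ω)) ≤ b →
      ∀ t : ℝ, 0 ≤ t → t ≤ 1 →
        Measurable (fun ω i => t * Y₁ ω i + (1 - t) * Y₂ ω i : Ω → Fin N → ℝ) ∧
        (∀ ω i, 0 ≤ t * Y₁ ω i + (1 - t) * Y₂ ω i) ∧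
        (∀ᵐ ω ∂P, ∑ i, (t * Y₁ ω i + (1 - t) * Y₂ ω i) = sysRisk P η A L b) ∧
        η (fun ω => aggLoss (fun i => A ω i + (t * Y₁ ω i + (1 - t) * Y₂ ω i)) (L ω)) ≤ b := by
  intro Y₁ Y₂ hY₁ hY₁nn hY₁sum hY₁b hY₂ hY₂nn hY₂sum hY₂b t ht0 ht1
  have hs : 0 ≤ 1 - t := sub_nonneg.2 ht1
  have hZ : Measurable (fun ω i => t * Y₁ ω i + (1 - t) * Y₂ ω i : Ω → Fin N → ℝ) := by
    fun_prop
  have hZnn : ∀ ω i, 0 ≤ t * Y₁ ω i + (1 - t) * Y₂ ω i := fun ω i =>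
    add_nonneg (mul_nonneg ht0 (hY₁nn ω i)) (mul_nonneg hs (hY₂nn ω i))
  refine ⟨hZ, hZnn, ?_, ?_⟩
  · filter_upwards [hY₁sum, hY₂sum] with ω h₁ h₂
    rw [Finset.sum_add_distrib, ← Finset.mul_sum, ← Finset.mul_sum, h₁, h₂]
    ring
  have hpos : ∀ Y : Ω → Fin N → ℝ, (∀ ω i, 0 ≤ Y ω i) → ∀ ω i, 0 < A ω i + Y ω i :=
    fun Y hY ω i => add_pos_of_pos_of_nonneg (hApos ω i) (hY ω i)
  have hint : ∀ Y : Ω → Fin N → ℝ, Measurable Y → (∀ ω i, 0 ≤ Y ω i) →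
      Integrable (fun ω => aggLoss (fun i => A ω i + Y ω i) (L ω)) P := fun Y hY hYnn =>
    integrable_aggLoss (A := fun ω i => A ω i + Y ω i) (by fun_prop) (hpos Y hYnn) hL hLnn hLint
  have hint₁ := hint Y₁ hY₁ hY₁nn
  have hint₂ := hint Y₂ hY₂ hY₂nn
  calc η (fun ω => aggLoss (fun i => A ω i + (t * Y₁ ω i + (1 - t) * Y₂ ω i)) (L ω))
      ≤ η (fun ω => t * aggLoss (fun i => A ω i + Y₁ ω i) (L ω) +
          (1 - t) * aggLoss (fun i => A ω i + Y₂ ω i) (L ω)) := by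
        refine hη_mono _ _ (hint _ hZ hZnn) ((hint₁.const_mul t).add (hint₂.const_mul (1 - t)))
          (Filter.Eventually.of_forall fun ω => ?_)
        convert aggLoss_convex (hpos Y₁ hY₁nn ω) (hpos Y₂ hY₂nn ω) (hLnn ω) ht0 ht1 using 3
        ring
    _ ≤ t * η (fun ω => aggLoss (fun i => A ω i + Y₁ ω i) (L ω)) +
          (1 - t) * η (fun ω => aggLoss (fun i => A ω i + Y₂ ω i) (L ω)) :=
        hη_conv _ _ hint₁ hint₂ t ht0 ht1
    _ ≤ t * b + (1 - t) * b :=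
        add_le_add (mul_le_mul_of_nonneg_left hY₁b ht0) (mul_le_mul_of_nonneg_left hY₂b hs)
    _ = b := by ring
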